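/- Let S, Y, U be random variables on a common probability space with values in nonempty finite sets and let ε ≥ 0. If I(U;S) ≤ ε, then I(U;Y) ≤ H(Y|S) + ε. (This is the converse/upper bound of Theorem 1 with Y = h(X).) -/

import Mathlib

open MeasureTheory ProbabilityTheory Real

noncomputable section

/-- The probability mass function of a random variable `X` under the measure `μ`. -/
def pm {Ω : Type*} [MeasurableSpace Ω] (μ : Measure Ω) {𝒳 : Type*} (X : Ω → 𝒳) (x : 𝒳) : ℝ :=
  (μ (X ⁻¹' {x})).toReal

/-- Shannon entropy (base 2) of a finite-valued random variable. -/
def ent {Ω : Type*} [MeasurableSpace Ω] (μ : Measure Ω) {𝒳 : Type*} [Fintype 𝒳]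
    (X : Ω → 𝒳) : ℝ :=
  -∑ x, pm μ X x * Real.logb 2 (pm μ X x)

/-- Conditional entropy `H(X|Y) = H(X,Y) - H(Y)` (base 2). -/
def condEnt {Ω : Type*} [MeasurableSpace Ω] (μ : Measure Ω) {𝒳 𝒴 : Type*} [Fintype 𝒳]
    [Fintype 𝒴] (X : Ω → 𝒳) (Y : Ω → 𝒴) : ℝ :=
  ent μ (fun ω => (X ω, Y ω)) - ent μ Y

/-- Mutual information `I(X;Y) = H(X) + H(Y) - H(X,Y)` (base 2). -/
def mi {Ω : Type*} [MeasurableSpace Ω] (μ : Measure Ω) {𝒳 𝒴 : Type*} [Fintype 𝒳]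
    [Fintype 𝒴] (X : Ω → 𝒳) (Y : Ω → 𝒴) : ℝ :=
  ent μ X + ent μ Y - ent μ (fun ω => (X ω, Y ω))

/-- Conditional mutual information `I(X;Y|Z) = H(X|Z) + H(Y|Z) - H((X,Y)|Z)` (base 2). -/
def condMI {Ω : Type*} [MeasurableSpace Ω] (μ : Measure Ω) {𝒳 𝒴 𝒵 : Type*} [Fintype 𝒳]
    [Fintype 𝒴] [Fintype 𝒵] (X : Ω → 𝒳) (Y : Ω → 𝒴) (Z : Ω → 𝒵) : ℝ :=
  condEnt μ X Z + condEnt μ Y Z - condEnt μ (fun ω => (X ω, Y ω)) Z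

/-- The law of `f ∘ W` is the push-forward of the law of `W`. -/
theorem pm_comp_eq_sum {Ω : Type*} [MeasurableSpace Ω] (μ : Measure Ω) [IsFiniteMeasure μ]
    {𝒲 𝒵 : Type*} [Fintype 𝒲] [MeasurableSpace 𝒲] [MeasurableSingletonClass 𝒲] [DecidableEq 𝒵]
    {W : Ω → 𝒲} (hW : Measurable W) (f : 𝒲 → 𝒵) (z : 𝒵) :
    pm μ (fun ω => f (W ω)) z = ∑ w, if f w = z then pm μ W w else 0 := by
  have h := sum_measureReal_preimage_singleton (μ := μ) (Finset.univ.filter fun w => f w = z)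
    (f := W) (fun w _ => hW (measurableSet_singleton w))
  rw [← Finset.sum_filter]
  refine Eq.trans ?_ h.symm
  unfold pm Measure.real
  congr 2
  ext ω
  simp

theorem pm_nonneg {Ω : Type*} [MeasurableSpace Ω] (μ : Measure Ω) {𝒳 : Type*} (X : Ω → 𝒳)
    (x : 𝒳) : 0 ≤ pm μ X x :=
  ENNReal.toReal_nonneg

theorem pm_le_pm_comp {Ω : Type*} [MeasurableSpace Ω] (μ : Measure Ω) [IsFiniteMeasure μ]
    {𝒲 𝒵 : Type*} (W : Ω → 𝒲) (f : 𝒲 → 𝒵) (w : 𝒲) :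
    pm μ W w ≤ pm μ (fun ω => f (W ω)) (f w) := by
  refine ENNReal.toReal_mono (measure_ne_top _ _) (measure_mono fun ω hω => ?_)
  simp_all

theorem sum_pm {Ω : Type*} [MeasurableSpace Ω] (μ : Measure Ω) [IsProbabilityMeasure μ]
    {𝒲 : Type*} [Fintype 𝒲] [MeasurableSpace 𝒲] [MeasurableSingletonClass 𝒲]
    {W : Ω → 𝒲} (hW : Measurable W) : ∑ w, pm μ W w = 1 := by
  have h := pm_comp_eq_sum μ hW (fun _ => ()) ()
  simpa [pm] using h.symm

theorem sum_pm_prod_right {Ω : Type*} [MeasurableSpace Ω] (μ : Measure Ω) [IsFiniteMeasure μ]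
    {𝒳 𝒴 : Type*} [Fintype 𝒳] [MeasurableSpace 𝒳] [MeasurableSingletonClass 𝒳]
    [Fintype 𝒴] [MeasurableSpace 𝒴] [MeasurableSingletonClass 𝒴]
    {X : Ω → 𝒳} {Y : Ω → 𝒴} (hX : Measurable X) (hY : Measurable Y) (x : 𝒳) :
    ∑ y, pm μ (fun ω => (X ω, Y ω)) (x, y) = pm μ X x := by
  classical
  rw [pm_comp_eq_sum μ (hX.prodMk hY) Prod.fst x, Fintype.sum_prod_type_right]
  simp

theorem sum_pm_prod_left {Ω : Type*} [MeasurableSpace Ω] (μ : Measure Ω) [IsFiniteMeasure μ]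
    {𝒳 𝒴 : Type*} [Fintype 𝒳] [MeasurableSpace 𝒳] [MeasurableSingletonClass 𝒳]
    [Fintype 𝒴] [MeasurableSpace 𝒴] [MeasurableSingletonClass 𝒴]
    {X : Ω → 𝒳} {Y : Ω → 𝒴} (hX : Measurable X) (hY : Measurable Y) (y : 𝒴) :
    ∑ x, pm μ (fun ω => (X ω, Y ω)) (x, y) = pm μ Y y := by
  classical
  rw [pm_comp_eq_sum μ (hX.prodMk hY) Prod.snd y, Fintype.sum_prod_type]
  simp

/-- The entropy of `f ∘ W` as an expectation under the law of `W`. -/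
theorem ent_comp {Ω : Type*} [MeasurableSpace Ω] (μ : Measure Ω) [IsFiniteMeasure μ]
    {𝒲 𝒵 : Type*} [Fintype 𝒲] [MeasurableSpace 𝒲] [MeasurableSingletonClass 𝒲] [Fintype 𝒵]
    {W : Ω → 𝒲} (hW : Measurable W) (f : 𝒲 → 𝒵) :
    ent μ (fun ω => f (W ω)) =
      -∑ w, pm μ W w * Real.logb 2 (pm μ (fun ω => f (W ω)) (f w)) := by
  classical
  rw [ent, neg_inj]
  calc ∑ z, pm μ (fun ω => f (W ω)) z * Real.logb 2 (pm μ (fun ω => f (W ω)) z)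
      = ∑ z, ∑ w, if f w = z then
          pm μ W w * Real.logb 2 (pm μ (fun ω => f (W ω)) z) else 0 := by
        refine Finset.sum_congr rfl fun z _ => ?_
        conv_lhs => rw [pm_comp_eq_sum μ hW f z, Finset.sum_mul]
        simp only [ite_mul, zero_mul, ← pm_comp_eq_sum μ hW f z]
    _ = _ := by
        rw [Finset.sum_comm]
        simp

/-- A consequence of submodularity and monotonicity:
`H(Y) + H(U,S) ≤ H(U,Y) + H(Y,S)`. -/
theorem ent_add_ent_prod_le {Ω : Type*} [MeasurableSpace Ω] (μ : Measure Ω)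
    [IsProbabilityMeasure μ] {𝒮 𝒴 𝒰 : Type*}
    [Fintype 𝒮] [MeasurableSpace 𝒮] [MeasurableSingletonClass 𝒮]
    [Fintype 𝒴] [MeasurableSpace 𝒴] [MeasurableSingletonClass 𝒴]
    [Fintype 𝒰] [MeasurableSpace 𝒰] [MeasurableSingletonClass 𝒰]
    {S : Ω → 𝒮} {Y : Ω → 𝒴} {U : Ω → 𝒰}
    (hS : Measurable S) (hY : Measurable Y) (hU : Measurable U) :
    ent μ Y + ent μ (fun ω => (U ω, S ω)) ≤
      ent μ (fun ω => (U ω, Y ω)) + ent μ (fun ω => (Y ω, S ω)) := by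
  let W : Ω → 𝒴 × 𝒰 × 𝒮 := fun ω => (Y ω, U ω, S ω)
  have hW : Measurable W := hY.prodMk (hU.prodMk hS)
  let a : 𝒴 × 𝒰 × 𝒮 → ℝ := fun w => pm μ Y w.1
  let b : 𝒴 × 𝒰 × 𝒮 → ℝ := fun w => pm μ (fun ω => (U ω, S ω)) w.2
  let c : 𝒴 × 𝒰 × 𝒮 → ℝ := fun w => pm μ (fun ω => (U ω, Y ω)) (w.2.1, w.1)
  let d : 𝒴 × 𝒰 × 𝒮 → ℝ := fun w => pm μ (fun ω => (Y ω, S ω)) (w.1, w.2.2)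
  have ha : ent μ Y = -∑ w, pm μ W w * Real.logb 2 (a w) := ent_comp μ hW Prod.fst
  have hb : ent μ (fun ω => (U ω, S ω)) = -∑ w, pm μ W w * Real.logb 2 (b w) :=
    ent_comp μ hW Prod.snd
  have hc : ent μ (fun ω => (U ω, Y ω)) = -∑ w, pm μ W w * Real.logb 2 (c w) :=
    ent_comp μ hW fun w => (w.2.1, w.1)
  have hd : ent μ (fun ω => (Y ω, S ω)) = -∑ w, pm μ W w * Real.logb 2 (d w) :=
    ent_comp μ hW fun w => (w.1, w.2.2)
  have h_mass : ∑ w, c w * d w / a w = 1 := by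
    rw [Fintype.sum_prod_type, ← sum_pm μ hY]
    refine Finset.sum_congr rfl fun y _ => ?_
    simp only [Fintype.sum_prod_type, a, c, d]
    simp only [← Finset.sum_div, ← Finset.mul_sum, ← Finset.sum_mul,
      sum_pm_prod_left μ hU hY, sum_pm_prod_right μ hY hS]
    exact mul_self_div_self _
  have h_log : 0 < Real.log 2 := Real.log_pos one_lt_two
  have h_term : ∀ w, pm μ W w * Real.logb 2 (c w) + pm μ W w * Real.logb 2 (d w)
      - pm μ W w * Real.logb 2 (a w) - pm μ W w * Real.logb 2 (b w)
      ≤ (c w * d w / a w - pm μ W w) / Real.log 2 := by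
    intro w
    have h_a : pm μ W w ≤ a w := pm_le_pm_comp μ W Prod.fst w
    have h_b : pm μ W w ≤ b w := pm_le_pm_comp μ W Prod.snd w
    have h_c : pm μ W w ≤ c w := pm_le_pm_comp μ W (fun w => (w.2.1, w.1)) w
    have h_d : pm μ W w ≤ d w := pm_le_pm_comp μ W (fun w => (w.1, w.2.2)) w
    rcases (pm_nonneg μ W w).eq_or_lt with h | h
    · rw [← h] at h_a h_c h_d ⊢
      simp only [zero_mul, add_zero, sub_zero]
      positivity
    · have a_pos := h.trans_le h_a
      have b_pos := h.trans_le h_b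
      have c_pos := h.trans_le h_c
      have d_pos := h.trans_le h_d
      have key := Real.log_le_sub_one_of_pos (x := c w * d w / a w / b w) (by positivity)
      rw [Real.log_div (by positivity) b_pos.ne', Real.log_div (by positivity) a_pos.ne',
        Real.log_mul c_pos.ne' d_pos.ne'] at key
      have h_le : pm μ W w * (c w * d w / a w / b w) ≤ c w * d w / a w := by
        rw [mul_div_assoc', div_le_iff₀ b_pos, mul_comm]
        gcongr
      rw [← mul_add, ← mul_sub, ← mul_sub]
      simp only [Real.logb, ← add_div, ← sub_div, mul_div_assoc']
      gcongr
      linarith [mul_le_mul_of_nonneg_left key h.le]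
  have h_sum := Finset.sum_le_sum fun w (_ : w ∈ Finset.univ) => h_term w
  simp only [Finset.sum_sub_distrib, Finset.sum_add_distrib, ← Finset.sum_div, h_mass,
    sum_pm μ hW, sub_self, zero_div] at h_sum
  rw [ha, hb, hc, hd]
  linarith

/-- If `I(U;S) ≤ ε` with `ε ≥ 0`, then `I(U;Y) ≤ H(Y|S) + ε`
(converse/upper bound of Theorem 1 with `Y = h(X)`). -/
theorem utility_upper_bound
    {Ω : Type*} [MeasurableSpace Ω] (μ : Measure Ω) [IsProbabilityMeasure μ]
    {𝒮 𝒴 𝒰 : Type*}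
    [Fintype 𝒮] [Nonempty 𝒮] [MeasurableSpace 𝒮] [MeasurableSingletonClass 𝒮]
    [Fintype 𝒴] [Nonempty 𝒴] [MeasurableSpace 𝒴] [MeasurableSingletonClass 𝒴]
    [Fintype 𝒰] [Nonempty 𝒰] [MeasurableSpace 𝒰] [MeasurableSingletonClass 𝒰]
    (S : Ω → 𝒮) (Y : Ω → 𝒴) (U : Ω → 𝒰)
    (hS : Measurable S) (hY : Measurable Y) (hU : Measurable U)
    (ε : ℝ) (hε0 : 0 ≤ ε) (hleak : mi μ U S ≤ ε) :
    mi μ U Y ≤ condEnt μ Y S + ε := by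
  have h := ent_add_ent_prod_le μ hS hY hU
  unfold mi condEnt at *
  linarith
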